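/- For every integer p ≥ 1 there is a constant C_p such that for all d ≥ 1 and all indices k, l, m, n ∈ {1,…,d} (not necessarily distinct): E[ |γ(k,l,m,n)|^{2p} ] ≤ C_p · d^{−3p}. -/

import Mathlib

open MeasureTheory

/-- The centered fourth-order eigenvector observable
`γ(k,ℓ,m,n) = ∑_j conj(ψ_{jk}) ψ_{jℓ} conj(ψ_{jm}) ψ_{jn} − (1/d)1_{k=ℓ,m=n} − (1/d)1_{k=n,ℓ=m}`. -/
noncomputable def gam {d : ℕ} (Ψ : Matrix (Fin d) (Fin d) ℂ) (k l m n : Fin d) : ℂ :=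
  (∑ j, (starRingEnd ℂ) (Ψ j k) * Ψ j l * (starRingEnd ℂ) (Ψ j m) * Ψ j n) -
    (1 / (d : ℂ)) * (if k = l ∧ m = n then 1 else 0) -
    (1 / (d : ℂ)) * (if k = n ∧ l = m then 1 else 0)

open ProbabilityTheory

lemma hx_indep {Ω : Type*} [MeasurableSpace Ω] (μ : Measure Ω) [IsProbabilityMeasure μ]
    (z : Ω → ℝ) (hzm : Measurable z) (d : ℕ) (s : Finset (Fin d)) (i : Fin d) (hi : i ∉ s) (a b : ℕ) :
    IndepFun (fun g : Fin d → Ω => (∑ j ∈ s, z (g j)) ^ a) (fun g => z (g i) ^ b)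
      (Measure.pi fun _ => μ) := by
  have h1 : iIndepFun (fun (i : Fin d) (g : Fin d → Ω) => z (g i)) (Measure.pi fun _ => μ) :=
    iIndepFun_pi (X := fun _ => z) (fun i => hzm.aemeasurable)
  have h2 := h1.indepFun_finsetSum_of_notMem (fun i => hzm.comp (measurable_pi_apply i)) hi
  have h3 := h2.comp (φ := fun x : ℝ => x ^ a) (ψ := fun x : ℝ => x ^ b) (by fun_prop) (by fun_prop)
  have e1 : (fun g : Fin d → Ω => (∑ j ∈ s, z (g j)) ^ a)
      = ((fun x : ℝ => x ^ a) ∘ ∑ j ∈ s, fun g : Fin d → Ω => z (g j)) := by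
    ext g; simp
  rw [e1]
  exact h3

lemma hx_term {Ω : Type*} [MeasurableSpace Ω] (μ : Measure Ω) [IsProbabilityMeasure μ]
    (z : Ω → ℝ) (hz : ∀ q : ℕ, Integrable (fun x => z x ^ q) μ) (d : ℕ) (i : Fin d) (q : ℕ) :
    Integrable (fun g : Fin d → Ω => z (g i) ^ q) (Measure.pi fun _ => μ) :=
  (measurePreserving_eval (fun _ : Fin d => μ) i).integrable_comp_of_integrable (hz q)

lemma hx_mom_int {Ω : Type*} [MeasurableSpace Ω] (μ : Measure Ω) [IsProbabilityMeasure μ]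
    (z : Ω → ℝ) (hzm : Measurable z) (hz : ∀ q : ℕ, Integrable (fun x => z x ^ q) μ)
    (d : ℕ) (s : Finset (Fin d)) : ∀ q : ℕ,
      Integrable (fun g : Fin d → Ω => (∑ j ∈ s, z (g j)) ^ q) (Measure.pi fun _ => μ) := by
  classical
  induction s using Finset.induction_on with
  | empty => intro q; simp
  | insert i s hi ih =>
    intro q
    simp_rw [Finset.sum_insert hi, add_comm (z _), add_pow]
    refine integrable_finsetSum _ fun m _ => ?_
    exact ((hx_indep μ z hzm d s i hi m (q - m)).integrable_mul (ih m) (hx_term μ z hz d i _)).mul_const _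

lemma hx_mom {Ω : Type*} [MeasurableSpace Ω] (μ : Measure Ω) [IsProbabilityMeasure μ]
    (z : Ω → ℝ) (hzm : Measurable z) (hz : ∀ q : ℕ, Integrable (fun x => z x ^ q) μ)
    (h0 : ∫ x, z x ∂μ = 0) : ∀ q : ℕ, ∃ C : ℝ, 0 ≤ C ∧ ∀ (d : ℕ) (s : Finset (Fin d)),
      |∫ g : Fin d → Ω, (∑ j ∈ s, z (g j)) ^ q ∂(Measure.pi fun _ => μ)| ≤ C * (s.card : ℝ) ^ (q / 2) := by
  classical
  have key : ∀ (d : ℕ) (s : Finset (Fin d)) (i : Fin d), i ∉ s → ∀ q : ℕ,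
      ∫ g : Fin d → Ω, (∑ j ∈ insert i s, z (g j)) ^ q ∂(Measure.pi fun _ => μ)
      = ∑ m ∈ Finset.range (q + 1), (∫ x, z x ^ m ∂μ) *
        (∫ g : Fin d → Ω, (∑ j ∈ s, z (g j)) ^ (q - m) ∂(Measure.pi fun _ => μ)) * (q.choose m) := by
    intro d s i hi q
    simp_rw [Finset.sum_insert hi, add_pow]
    have hint : ∀ m : ℕ, Integrable (fun g : Fin d → Ω => (z (g i)) ^ m * (∑ j ∈ s, z (g j)) ^ (q - m))
        (Measure.pi fun _ => μ) := fun m =>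
      (hx_indep μ z hzm d s i hi (q-m) m).symm.integrable_mul (hx_term μ z hz d i _)
        (hx_mom_int μ z hzm hz d s _)
    rw [integral_finsetSum _ fun m _ => (hint m).mul_const _]
    refine Finset.sum_congr rfl fun m _ => ?_
    rw [integral_mul_const]
    congr 1
    have := (hx_indep μ z hzm d s i hi (q-m) m).symm.integral_mul_eq_mul_integral
      (hx_term μ z hz d i _).aestronglyMeasurable (hx_mom_int μ z hzm hz d s _).aestronglyMeasurable
    simp only [Pi.mul_apply] at this
    rw [this]
    congr 1
    exact integral_comp_eval (μ := fun _ : Fin d => μ) (i := i) (f := fun x => z x ^ m)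
      (hz m).aestronglyMeasurable
  intro q
  induction q using Nat.strong_induction_on with
  | _ q ih =>
  match q, ih with
  | 0, _ => exact ⟨1, zero_le_one, fun d s => by simp⟩
  | 1, _ =>
    refine ⟨0, le_rfl, fun d s => ?_⟩
    induction s using Finset.induction_on with
    | empty => simp
    | insert i s hi ihs =>
      rw [key d s i hi 1]
      simp only [Finset.sum_range_succ, Finset.sum_range_zero]
      simp only [zero_mul, abs_nonpos_iff] at ihs
      simp [h0]
      simpa using ihs
  | r + 2, ih =>
    choose! Cf hC0 hC using ih
    set K : ℝ := ∑ m ∈ Finset.range (r + 1), |∫ x, z x ^ (m + 2) ∂μ| * Cf (r - m) * ((r+2).choose (m+2)) with hK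
    have hK0 : 0 ≤ K := by
      refine Finset.sum_nonneg fun m hm => ?_
      have := hC0 (r - m) (by omega)
      positivity
    refine ⟨K, hK0, fun d s => ?_⟩
    induction s using Finset.induction_on with
    | empty => simp
    | insert i s hi ihs =>
      rw [key d s i hi (r+2), Finset.sum_range_succ', Finset.sum_range_succ']
      have e2 : (r + 2) / 2 = r / 2 + 1 := by omega
      simp only [h0, pow_one, zero_add, zero_mul, pow_zero, integral_const, probReal_univ, smul_eq_mul, mul_one, one_mul, Nat.choose_zero_right, Nat.cast_one, Nat.sub_zero, add_zero]
      rw [Finset.card_insert_of_notMem hi]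
      rw [e2] at ihs ⊢
      rw [Nat.cast_succ]
      set n : ℝ := (s.card : ℝ) with hn
      have hn0 : 0 ≤ n := by positivity
      have hb : |∑ m ∈ Finset.range (r + 1), (∫ x, z x ^ (m + 1 + 1) ∂μ) *
        (∫ g : Fin d → Ω, (∑ j ∈ s, z (g j)) ^ (r + 2 - (m + 1 + 1)) ∂(Measure.pi fun _ => μ)) * ((r+2).choose (m+1+1))| ≤ K * (n + 1) ^ (r / 2) := by
        refine (Finset.abs_sum_le_sum_abs _ _).trans ?_
        rw [hK, Finset.sum_mul]
        refine Finset.sum_le_sum fun m hm => ?_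
        have e3 : r + 2 - (m + 1 + 1) = r - m := by omega
        rw [e3, abs_mul, abs_mul, Nat.abs_cast]
        have h4 := hC (r - m) (by omega) d s
        have h5 : n ^ ((r - m) / 2) ≤ (n + 1) ^ (r / 2) :=
          calc n ^ ((r - m) / 2) ≤ (n+1) ^ ((r - m) / 2) := by gcongr; linarith
            _ ≤ (n + 1) ^ (r / 2) := by
              apply pow_le_pow_right₀ (by linarith); omega
        have h6 := hC0 (r - m) (by omega)
        have h7 := h4.trans (mul_le_mul_of_nonneg_left h5 h6)
        calc _ ≤ |∫ x, z x ^ (m + 2) ∂μ| * (Cf (r - m) * (n + 1) ^ (r / 2)) * ((r+2).choose (m+2)) := by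
              gcongr
          _ = _ := by ring
      calc _ ≤ K * (n + 1) ^ (r / 2) + K * n ^ (r / 2 + 1) := (abs_add_le _ _).trans (add_le_add hb ihs)
        _ ≤ K * (n + 1) ^ (r / 2) + K * (n * (n + 1) ^ (r / 2)) := by
          rw [pow_succ' n]
          gcongr
          linarith
        _ = _ := by ring

/-- density of the standard complex Gaussian -/
noncomputable def hxRho (z : ℂ) : ℝ := Real.pi⁻¹ * Real.exp (-‖z‖ ^ 2)

/-- standard complex Gaussian measure -/
noncomputable def hxGam : Measure ℂ := (volume : Measure ℂ).withDensity fun z => ENNReal.ofReal (hxRho z)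

lemma hxRho_nonneg (z : ℂ) : 0 ≤ hxRho z := by unfold hxRho; positivity

lemma hxRho_cont : Continuous hxRho := by unfold hxRho; fun_prop

lemma hx_int_base (q : ℕ) : ∫ z : ℂ, hxRho z * ‖z‖ ^ (2 * q) = (q.factorial : ℝ) := by
  have h := Complex.integral_rpow_mul_exp_neg_rpow (p := 2) (q := 2 * q) (by norm_num) (by
    have : (0:ℝ) ≤ q := by positivity
    linarith)
  have e : (2 * (q:ℝ) + 2) / 2 = q + 1 := by ring
  rw [e, Real.Gamma_nat_eq_factorial] at h
  have h2 : ∀ z : ℂ, hxRho z * ‖z‖ ^ (2 * q) = Real.pi⁻¹ * (‖z‖ ^ (2 * (q:ℝ)) * Real.exp (-‖z‖ ^ (2:ℝ))) := by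
    intro z
    have : (2 * (q:ℝ)) = ((2 * q : ℕ) : ℝ) := by push_cast; ring
    rw [this, Real.rpow_natCast, Real.rpow_two, hxRho]; ring
  simp_rw [h2]
  rw [integral_const_mul, h]
  field_simp

lemma hx_intble_base (q : ℕ) : Integrable (fun z : ℂ => hxRho z * ‖z‖ ^ (2 * q)) := by
  by_contra hcon
  have := hx_int_base q
  rw [integral_undef hcon] at this
  have h2 := Nat.factorial_pos q
  have : (q.factorial : ℝ) ≠ 0 := by positivity
  simp_all

instance hx_prob : IsProbabilityMeasure hxGam := by
  constructor
  rw [hxGam, withDensity_apply _ MeasurableSet.univ, Measure.restrict_univ,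
    ← ofReal_integral_eq_lintegral_ofReal]
  · have := hx_int_base 0
    simp at this
    simp [this]
  · simpa using hx_intble_base 0
  · exact Filter.Eventually.of_forall hxRho_nonneg

lemma hx_integral_gam (f : ℂ → ℝ) : ∫ z, f z ∂hxGam = ∫ z, hxRho z * f z := by
  rw [hxGam, integral_withDensity_eq_integral_toReal_smul]
  · simp [ENNReal.toReal_ofReal (hxRho_nonneg _)]
  · exact hxRho_cont.measurable.ennreal_ofReal
  · simp

lemma hx_integrable_gam (f : ℂ → ℝ) : Integrable f hxGam ↔ Integrable fun z => hxRho z * f z := by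
  rw [hxGam, integrable_withDensity_iff_integrable_smul']
  · simp [ENNReal.toReal_ofReal (hxRho_nonneg _)]
  · exact hxRho_cont.measurable.ennreal_ofReal
  · simp

lemma hx_y_int (q : ℕ) : Integrable (fun z : ℂ => (‖z‖ ^ 2) ^ q) hxGam := by
  rw [hx_integrable_gam]; simpa [pow_mul] using hx_intble_base q

lemma hx_y_mom (q : ℕ) : ∫ z : ℂ, (‖z‖ ^ 2) ^ q ∂hxGam = (q.factorial : ℝ) := by
  rw [hx_integral_gam]; simpa [pow_mul] using hx_int_base q

lemma hx_y_poly (P : Polynomial ℝ) : Integrable (fun z : ℂ => P.eval (‖z‖ ^ 2)) hxGam := by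
  simp_rw [Polynomial.eval_eq_sum_range]
  exact integrable_finsetSum _ fun m _ => (hx_y_int m).const_mul _

lemma hx_z1_int (q : ℕ) : Integrable (fun z : ℂ => (‖z‖ ^ 2 - 1) ^ q) hxGam := by
  have := hx_y_poly ((Polynomial.X - 1) ^ q)
  simpa using this

lemma hx_z2_int (q : ℕ) : Integrable (fun z : ℂ => ((‖z‖ ^ 2) ^ 2 - 4 * ‖z‖ ^ 2 + 2) ^ q) hxGam := by
  have := hx_y_poly ((Polynomial.X ^ 2 - Polynomial.C 4 * Polynomial.X + Polynomial.C 2) ^ q)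
  simpa using this

lemma hx_z1_mean : ∫ z : ℂ, (‖z‖ ^ 2 - 1) ∂hxGam = 0 := by
  have h1 := hx_y_mom 1
  have i1 := hx_y_int 1
  simp only [pow_one] at h1 i1
  rw [integral_sub i1 (integrable_const _), h1]; simp

lemma hx_z2_mean : ∫ z : ℂ, ((‖z‖ ^ 2) ^ 2 - 4 * ‖z‖ ^ 2 + 2) ∂hxGam = 0 := by
  have h1 := hx_y_mom 1
  have i1 := hx_y_int 1
  simp only [pow_one] at h1 i1
  have h2 := hx_y_mom 2
  have i2 := hx_y_int 2
  have i3 : Integrable (fun z : ℂ => (‖z‖ ^ 2) ^ 2 - 4 * ‖z‖ ^ 2) hxGam := i2.sub (i1.const_mul 4)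
  rw [integral_add i3 (integrable_const _), integral_sub i2 (i1.const_mul 4),
    integral_const_mul, h1, h2]; norm_num [Nat.factorial]

/-- the basic quartic functional -/
noncomputable def hxN {d : ℕ} (w : Fin d → ℂ) : ℝ :=
  ∑ j, ‖w j‖ ^ 4 - 2 / (d : ℝ) * (∑ j, ‖w j‖ ^ 2) ^ 2

lemma hx_boundA (p : ℕ) : ∃ C : ℝ, 0 ≤ C ∧ ∀ d : ℕ, 1 ≤ d →
    ∫⁻ g : Fin d → ℂ, ENNReal.ofReal (hxN g ^ (2 * p)) ∂(Measure.pi fun _ => hxGam)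
      ≤ ENNReal.ofReal (C * (d : ℝ) ^ p) := by
  obtain ⟨C1, hC1, h1⟩ := hx_mom hxGam _ (by fun_prop) hx_z1_int hx_z1_mean (4 * p)
  obtain ⟨C2, hC2, h2⟩ := hx_mom hxGam _ (by fun_prop) hx_z2_int hx_z2_mean (2 * p)
  refine ⟨2 ^ (2 * p - 1) * (C2 + 4 ^ p * C1), by positivity, fun d hd => ?_⟩
  have i1 := hx_mom_int hxGam _ (by fun_prop) hx_z1_int d Finset.univ (4 * p)
  have i2 := hx_mom_int hxGam _ (by fun_prop) hx_z2_int d Finset.univ (2 * p)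
  have h1 := (le_abs_self _).trans (h1 d Finset.univ)
  have h2 := (le_abs_self _).trans (h2 d Finset.univ)
  have hd' : (1:ℝ) ≤ d := by exact_mod_cast hd
  set X : (Fin d → ℂ) → ℝ := fun g => ∑ j, ((‖g j‖ ^ 2) ^ 2 - 4 * ‖g j‖ ^ 2 + 2) with hX
  set Y : (Fin d → ℂ) → ℝ := fun g => ∑ j, (‖g j‖ ^ 2 - 1) with hY
  have hN : ∀ g : Fin d → ℂ, hxN g = X g + (-(2 / (d:ℝ)) * Y g ^ 2) := by
    intro g
    simp only [hxN, hX, hY, Finset.sum_add_distrib, Finset.sum_sub_distrib, ← Finset.mul_sum]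
    simp only [← pow_mul]
    simp
    field_simp
    ring
  have hb : ∀ g : Fin d → ℂ, hxN g ^ (2 * p) ≤ 2 ^ (2 * p - 1) * (X g ^ (2 * p) + (2 / (d:ℝ)) ^ (2 * p) * Y g ^ (4 * p)) := by
    intro g
    rw [hN]
    refine (Even.add_pow_le (even_two_mul p)).trans (le_of_eq ?_)
    rw [mul_pow, (even_two_mul p).neg_pow, ← pow_mul]
    congr 4; ring
  calc _ ≤ ∫⁻ g : Fin d → ℂ, ENNReal.ofReal (2 ^ (2 * p - 1) * (X g ^ (2 * p) + (2 / (d:ℝ)) ^ (2 * p) * Y g ^ (4 * p))) ∂(Measure.pi fun _ => hxGam) :=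
        lintegral_mono fun g => ENNReal.ofReal_le_ofReal (hb g)
    _ = ENNReal.ofReal (∫ g : Fin d → ℂ, (2 ^ (2 * p - 1) * (X g ^ (2 * p) + (2 / (d:ℝ)) ^ (2 * p) * Y g ^ (4 * p))) ∂(Measure.pi fun _ => hxGam)) := by
        rw [ofReal_integral_eq_lintegral_ofReal]
        · exact (i2.add (i1.const_mul _)).const_mul _
        · refine Filter.Eventually.of_forall fun g => ?_
          have a1 : 0 ≤ X g ^ (2 * p) := (even_two_mul p).pow_nonneg _
          have a2 : 0 ≤ Y g ^ (4 * p) := Even.pow_nonneg ⟨2 * p, by ring⟩ _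
          positivity
    _ ≤ _ := by
        apply ENNReal.ofReal_le_ofReal
        rw [integral_const_mul, integral_add i2 (i1.const_mul _), integral_const_mul, mul_assoc]
        simp only [Finset.card_univ, Fintype.card_fin] at h1 h2
        rw [show 4 * p / 2 = 2 * p by omega] at h1
        rw [show 2 * p / 2 = p by omega] at h2
        refine mul_le_mul_of_nonneg_left ?_ (by positivity)
        calc _ ≤ C2 * (d:ℝ) ^ p + (2 / (d:ℝ)) ^ (2 * p) * (C1 * (d:ℝ) ^ (2 * p)) := by gcongr
          _ = C2 * (d:ℝ) ^ p + 4 ^ p * C1 * 1 := by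
              rw [div_pow, pow_mul 2 2 p]; field_simp; norm_num; ring
          _ ≤ C2 * (d:ℝ) ^ p + 4 ^ p * C1 * (d:ℝ) ^ p := by
              gcongr
              exact one_le_pow₀ hd'
          _ = _ := by ring

lemma hx_boundB (n d : ℕ) :
    ENNReal.ofReal ((d:ℝ) ^ n) ≤
    ∫⁻ g : Fin d → ℂ, ENNReal.ofReal ((∑ j, ‖g j‖ ^ 2) ^ n) ∂(Measure.pi fun _ => hxGam) := by
  have i1 := fun q => hx_mom_int hxGam (fun z : ℂ => ‖z‖ ^ 2) (by fun_prop) hx_y_int d Finset.univ q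
  have im : ∫ g : Fin d → ℂ, (∑ j, ‖g j‖ ^ 2) ∂(Measure.pi fun _ => hxGam) = d := by
    have ii : ∀ j : Fin d, Integrable (fun g : Fin d → ℂ => ‖g j‖ ^ 2) (Measure.pi fun _ => hxGam) := by
      intro j
      simpa using hx_term hxGam (fun z : ℂ => ‖z‖ ^ 2) hx_y_int d j 1
    rw [integral_finsetSum _ fun j _ => ii j]
    have : ∀ j : Fin d, ∫ g : Fin d → ℂ, ‖g j‖ ^ 2 ∂(Measure.pi fun _ => hxGam) = 1 := by
      intro j
      rw [integral_comp_eval (μ := fun _ : Fin d => hxGam) (i := j) (f := fun x : ℂ => ‖x‖ ^ 2)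
        (by fun_prop)]
      simpa using hx_y_mom 1
    simp [this]
  rw [← ofReal_integral_eq_lintegral_ofReal (i1 n) (Filter.Eventually.of_forall fun g => by positivity)]
  apply ENNReal.ofReal_le_ofReal
  have := (convexOn_pow (𝕜 := ℝ) n).map_integral_le (μ := Measure.pi fun _ : Fin d => hxGam)
    (f := fun g : Fin d → ℂ => ∑ j, ‖g j‖ ^ 2) (by fun_prop) isClosed_Ici
    (Filter.Eventually.of_forall fun g => by simp only [Set.mem_Ici]; positivity) (by simpa using i1 1) (i1 n)
  rwa [im] at this

lemma hx_pi_density (d : ℕ) : (Measure.pi fun _ : Fin d => hxGam) =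
    (volume : Measure (Fin d → ℂ)).withDensity fun g => ENNReal.ofReal (∏ j, hxRho (g j)) := by
  refine Measure.pi_eq (μ := fun _ : Fin d => hxGam) fun s hs => ?_
  have hi : Integrable hxRho := by simpa using hx_intble_base 0
  have e1 : ∀ i, hxGam (s i) = ENNReal.ofReal (∫ x, (s i).indicator hxRho x) := by
    intro i
    rw [hxGam, withDensity_apply _ (hs i), integral_indicator (hs i),
      ofReal_integral_eq_lintegral_ofReal hi.integrableOn (Filter.Eventually.of_forall hxRho_nonneg)]
  have e2 : ∀ g : Fin d → ℂ, (Set.univ.pi s).indicator (fun g : Fin d → ℂ => ∏ j, hxRho (g j)) g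
      = ∏ j, (s j).indicator hxRho (g j) := by
    intro g
    by_cases h : g ∈ Set.univ.pi s
    · rw [Set.indicator_of_mem h]
      refine Finset.prod_congr rfl fun j _ => ?_
      rw [Set.indicator_of_mem (h j (Set.mem_univ j))]
    · rw [Set.indicator_of_notMem h]
      simp only [Set.mem_pi, Set.mem_univ, true_implies, not_forall] at h
      obtain ⟨j, hj⟩ := h
      exact (Finset.prod_eq_zero (Finset.mem_univ j) (Set.indicator_of_notMem hj _)).symm
  simp_rw [e1]
  rw [withDensity_apply _ (MeasurableSet.univ_pi hs),
    ← ofReal_integral_eq_lintegral_ofReal, ← integral_indicator (MeasurableSet.univ_pi hs)]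
  · simp_rw [e2]
    rw [integral_fintype_prod_volume_eq_prod (fun j x => (s j).indicator hxRho x),
      ENNReal.ofReal_prod_of_nonneg]
    exact fun i _ => integral_nonneg fun x => Set.indicator_nonneg (fun z _ => hxRho_nonneg z) x
  · exact (Integrable.fintype_prod (f := fun _ : Fin d => hxRho) fun _ => hi).integrableOn
  · exact Filter.Eventually.of_forall fun g => Finset.prod_nonneg fun j _ => hxRho_nonneg _

lemma hx_norm_sum {d : ℕ} (w : Fin d → ℂ) : ((∑ j, ‖w j‖ ^ 2 : ℝ) : ℂ) = star w ⬝ᵥ w := by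
  simp [dotProduct, Complex.conj_mul']

lemma hx_norm_pres {d : ℕ} (U : Matrix.unitaryGroup (Fin d) ℂ) (w : Fin d → ℂ) :
    ∑ j, ‖(U.1.mulVec w) j‖ ^ 2 = ∑ j, ‖w j‖ ^ 2 := by
  have : ((∑ j, ‖(U.1.mulVec w) j‖ ^ 2 : ℝ) : ℂ) = ((∑ j, ‖w j‖ ^ 2 : ℝ) : ℂ) := by
    rw [hx_norm_sum, hx_norm_sum, Matrix.star_mulVec, ← Matrix.dotProduct_mulVec, Matrix.mulVec_mulVec]
    have h : U.1.conjTranspose * U.1 = 1 := (Matrix.mem_unitaryGroup_iff').1 U.2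
    rw [h, Matrix.one_mulVec]
  exact_mod_cast this

lemma hx_vol_pres {d : ℕ} (U : Matrix.unitaryGroup (Fin d) ℂ) :
    MeasurePreserving (fun w : Fin d → ℂ => U.1.mulVec w) volume volume := by
  have hdet : LinearMap.det ((Matrix.toLin' U.1).restrictScalars ℝ) = 1 := by
    rw [LinearMap.det_restrictScalars, Algebra.norm_complex_apply, LinearMap.det_toLin']
    have h := (Matrix.det_of_mem_unitary U.2).1
    rw [Complex.star_def, ← Complex.normSq_eq_conj_mul_self] at h
    exact_mod_cast h
  refine ⟨by fun_prop, ?_⟩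
  have := Measure.map_linearMap_addHaar_eq_smul_addHaar (volume : Measure (Fin d → ℂ))
    (f := (Matrix.toLin' U.1).restrictScalars ℝ) (by rw [hdet]; norm_num)
  rw [hdet] at this
  simp only [inv_one, abs_one, ENNReal.ofReal_one, one_smul] at this
  exact this

lemma hx_rho_prod {d : ℕ} (w : Fin d → ℂ) : ∏ j, hxRho (w j) = (Real.pi⁻¹) ^ d * Real.exp (-∑ j, ‖w j‖ ^ 2) := by
  simp only [hxRho, Finset.prod_mul_distrib, ← Real.exp_sum]
  simp

lemma hx_gauss_inv {d : ℕ} (U : Matrix.unitaryGroup (Fin d) ℂ) (F : (Fin d → ℂ) → ENNReal)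
    (hF : Measurable F) : ∫⁻ g, F (U.1.mulVec g) ∂(Measure.pi fun _ : Fin d => hxGam) =
      ∫⁻ g, F g ∂(Measure.pi fun _ : Fin d => hxGam) := by
  have hm : Measurable (fun w : Fin d → ℂ => U.1.mulVec w) := (hx_vol_pres U).measurable
  have hr : Measurable fun g : Fin d → ℂ => ENNReal.ofReal (∏ j, hxRho (g j)) := by
    have := hxRho_cont
    fun_prop
  rw [hx_pi_density, lintegral_withDensity_eq_lintegral_mul _ hr
      (show Measurable fun g => F (U.1.mulVec g) from hF.comp hm),
    lintegral_withDensity_eq_lintegral_mul _ hr hF, ← (hx_vol_pres U).lintegral_comp (hr.mul hF)]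
  refine lintegral_congr fun g => ?_
  simp only [Pi.mul_apply, Function.comp, hx_rho_prod, hx_norm_pres]

lemma hx_right_inv {G : Type*} [Group G] [TopologicalSpace G] [IsTopologicalGroup G]
    [SecondCountableTopology G] [MeasurableSpace G] [BorelSpace G] (P : Measure G)
    [IsProbabilityMeasure P] (hP : ∀ g : G, P.map (fun x => g * x) = P) (F : G → ENNReal)
    (hF : Measurable F) (h : G) : ∫⁻ x, F (x * h) ∂P = ∫⁻ x, F x ∂P := by
  have hl : ∀ (g : G) (F : G → ENNReal), Measurable F → ∫⁻ x, F (g * x) ∂P = ∫⁻ x, F x ∂P := by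
    intro g F hF
    conv_rhs => rw [← hP g]
    rw [lintegral_map hF (by fun_prop)]
  have key : ∀ h : G, ∫⁻ x, F (x * h) ∂P = ∫⁻ y, F y⁻¹ ∂P := by
    intro h
    calc ∫⁻ x, F (x * h) ∂P = ∫⁻ y, ∫⁻ x, F (y⁻¹ * x * h) ∂P ∂P := by
          have : ∀ y : G, ∫⁻ x, F (y⁻¹ * x * h) ∂P = ∫⁻ x, F (x * h) ∂P := fun y =>
            hl y⁻¹ (fun x => F (x * h)) (by fun_prop)
          simp [this]
      _ = ∫⁻ x, ∫⁻ y, F (y⁻¹ * x * h) ∂P ∂P := by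
          apply lintegral_lintegral_swap
          apply Measurable.aemeasurable
          apply hF.comp
          fun_prop
      _ = ∫⁻ y, F y⁻¹ ∂P := by
          have : ∀ x : G, ∫⁻ y, F (y⁻¹ * x * h) ∂P = ∫⁻ y, F y⁻¹ ∂P := fun x => by
            rw [← hl (x * h)⁻¹ (fun y => F y⁻¹) (by fun_prop)]
            simp [mul_assoc]
          simp [this]
  rw [key h, ← key 1]; simp

lemma hx_trans0 {d : ℕ} (i : Fin d) (w : Fin d → ℂ) (hw : ∑ j, ‖w j‖ ^ 2 = 1) :
    ∃ U : Matrix.unitaryGroup (Fin d) ℂ, U.1.mulVec (Pi.single i 1) = w := by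
  have hn : ‖(WithLp.toLp 2 w : EuclideanSpace ℂ (Fin d))‖ = 1 := by
    rw [EuclideanSpace.norm_eq]; simp [hw]
  obtain ⟨b, hb⟩ := Orthonormal.exists_orthonormalBasis_extension_of_card_eq (𝕜 := ℂ)
    (E := EuclideanSpace ℂ (Fin d)) (ι := Fin d) (by simp) (v := fun _ => WithLp.toLp 2 w) (s := {i}) (by
      constructor
      · intro x; simpa using hn
      · intro x y hxy
        exact absurd (Subsingleton.elim x y) hxy)
  refine ⟨⟨_, (EuclideanSpace.basisFun (Fin d) ℂ).toMatrix_orthonormalBasis_mem_unitary b⟩, ?_⟩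
  ext j
  simp [Module.Basis.toMatrix_apply, hb i rfl]

lemma hx_trans {d : ℕ} (i : Fin d) (v w : Fin d → ℂ) (hv : ∑ j, ‖v j‖ ^ 2 = 1) (hw : ∑ j, ‖w j‖ ^ 2 = 1) :
    ∃ U : Matrix.unitaryGroup (Fin d) ℂ, U.1.mulVec v = w := by
  obtain ⟨A, hA⟩ := hx_trans0 i v hv
  obtain ⟨B, hB⟩ := hx_trans0 i w hw
  refine ⟨B * A⁻¹, ?_⟩
  rw [← hA, Matrix.mulVec_mulVec]
  have : (B * A⁻¹).1 * A.1 = B.1 := by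
    have : (B * A⁻¹ * A) = B := by group
    exact congrArg Subtype.val this
  rw [this, hB]

lemma hxN_cont {d : ℕ} : Continuous (hxN : (Fin d → ℂ) → ℝ) := by unfold hxN; fun_prop

lemma hxN_smul {d : ℕ} (r : ℝ) (w : Fin d → ℂ) : hxN ((r : ℂ) • w) = r ^ 4 * hxN w := by
  simp only [hxN, Pi.smul_apply, smul_eq_mul, norm_mul, Complex.norm_real, mul_pow, ← Finset.mul_sum]
  simp only [Real.norm_eq_abs, sq_abs]
  rw [show |r| ^ 4 = r ^ 4 from Even.pow_abs (by decide) r]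
  ring

instance hx_scU (d : ℕ) : SecondCountableTopology (Matrix.unitaryGroup (Fin d) ℂ) := by
  have : SecondCountableTopology (Matrix (Fin d) (Fin d) ℂ) :=
    inferInstanceAs (SecondCountableTopology (Fin d → Fin d → ℂ))
  exact TopologicalSpace.Subtype.secondCountableTopology _

lemma hx_mulVec_cont (d : ℕ) : Continuous fun x : Matrix.unitaryGroup (Fin d) ℂ × (Fin d → ℂ) =>
    x.1.1.mulVec x.2 := by
  exact Continuous.matrix_mulVec (continuous_subtype_val.comp continuous_fst) continuous_snd

lemma hx_haar (p : ℕ) (hp : 1 ≤ p) : ∃ C : ℝ, 0 ≤ C ∧ ∀ d : ℕ, 1 ≤ d →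
      ∀ [MeasurableSpace (Matrix.unitaryGroup (Fin d) ℂ)]
        [BorelSpace (Matrix.unitaryGroup (Fin d) ℂ)]
        (P : Measure (Matrix.unitaryGroup (Fin d) ℂ)) [IsProbabilityMeasure P],
        (∀ g : Matrix.unitaryGroup (Fin d) ℂ, P.map (fun x => g * x) = P) →
        ∀ v : Fin d → ℂ, ∫⁻ Ψ, ENNReal.ofReal (hxN (Ψ.1.mulVec v) ^ (2 * p)) ∂P ≤
          ENNReal.ofReal ((∑ j, ‖v j‖ ^ 2) ^ (4 * p) * (C / (d:ℝ) ^ (3 * p))) := by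
  obtain ⟨C, hC, hA⟩ := hx_boundA p
  refine ⟨C, hC, fun d hd _ _ P _ hP v => ?_⟩
  have i0 : Fin d := ⟨0, hd⟩
  have hFc : Continuous fun w : Fin d → ℂ => ENNReal.ofReal (hxN w ^ (2 * p)) :=
    ENNReal.continuous_ofReal.comp (hxN_cont.pow _)
  have hmv : ∀ w : Fin d → ℂ, Continuous fun Ψ : Matrix.unitaryGroup (Fin d) ℂ => Ψ.1.mulVec w :=
    fun w => (hx_mulVec_cont d).comp (by fun_prop : Continuous fun Ψ => (Ψ, w))
  set u : Fin d → ℂ := Pi.single i0 1 with hu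
  have hu1 : ∑ j, ‖u j‖ ^ 2 = 1 := by
    rw [Finset.sum_eq_single i0]
    · simp [hu]
    · intro j _ hj; simp [hu, hj]
    · simp
  set B := ∫⁻ Ψ, ENNReal.ofReal (hxN (Ψ.1.mulVec u) ^ (2 * p)) ∂P with hB
  have hgen : ∀ w : Fin d → ℂ, ∫⁻ Ψ, ENNReal.ofReal (hxN (Ψ.1.mulVec w) ^ (2 * p)) ∂P =
      ENNReal.ofReal ((∑ j, ‖w j‖ ^ 2) ^ (4 * p)) * B := by
    intro w
    set S := ∑ j, ‖w j‖ ^ 2 with hS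
    have hS0 : 0 ≤ S := by positivity
    rcases hS0.eq_or_lt with h | h
    · have hw : w = 0 := by
        have := (Finset.sum_eq_zero_iff_of_nonneg (fun j _ => by positivity)).1 h.symm
        ext j; simpa using this j (Finset.mem_univ j)
      rw [← h, hw]
      simp [hxN, show p ≠ 0 by omega]
    · set r := Real.sqrt S with hr
      have hr0 : 0 < r := Real.sqrt_pos.2 h
      have hrS : r ^ 2 = S := Real.sq_sqrt hS0
      obtain ⟨V, hV⟩ := hx_trans i0 u (((r⁻¹ : ℝ) : ℂ) • w) hu1 (by
        simp only [Pi.smul_apply, smul_eq_mul, norm_mul, Complex.norm_real, mul_pow, ← Finset.mul_sum, ← hS]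
        rw [Real.norm_eq_abs, sq_abs, ← hrS]; field_simp)
      have hw : w = (r : ℂ) • V.1.mulVec u := by
        rw [hV, smul_smul, ← Complex.ofReal_mul, mul_inv_cancel₀ hr0.ne']; simp
      have hpt : ∀ Ψ : Matrix.unitaryGroup (Fin d) ℂ, ENNReal.ofReal (hxN (Ψ.1.mulVec w) ^ (2 * p))
          = ENNReal.ofReal (S ^ (4 * p)) * ENNReal.ofReal (hxN ((Ψ * V).1.mulVec u) ^ (2 * p)) := by
        intro Ψ
        rw [← ENNReal.ofReal_mul (by positivity)]
        congr 1
        conv_lhs => rw [hw]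
        rw [Matrix.mulVec_smul, hxN_smul, Matrix.mulVec_mulVec, mul_pow, ← hrS]
        congr 1
        ring
      simp_rw [hpt]
      rw [lintegral_const_mul _ (by
          refine (hFc.comp ((hmv u).comp ?_)).measurable
          fun_prop)]
      rw [hx_right_inv P hP (fun Ψ => ENNReal.ofReal (hxN (Ψ.1.mulVec u) ^ (2 * p)))
        (hFc.comp (hmv u)).measurable V]
  have hB2 : ENNReal.ofReal ((d:ℝ) ^ (4 * p)) * B ≤ ENNReal.ofReal (C * (d : ℝ) ^ p) := by
    calc _ ≤ (∫⁻ g : Fin d → ℂ, ENNReal.ofReal ((∑ j, ‖g j‖ ^ 2) ^ (4 * p)) ∂(Measure.pi fun _ => hxGam)) * B := by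
          gcongr; exact hx_boundB (4 * p) d
      _ = ∫⁻ g : Fin d → ℂ, ENNReal.ofReal ((∑ j, ‖g j‖ ^ 2) ^ (4 * p)) * B ∂(Measure.pi fun _ => hxGam) := by
          rw [lintegral_mul_const]
          fun_prop
      _ = ∫⁻ g : Fin d → ℂ, ∫⁻ Ψ, ENNReal.ofReal (hxN (Ψ.1.mulVec g) ^ (2 * p)) ∂P ∂(Measure.pi fun _ => hxGam) := by
          simp_rw [hgen]
      _ = ∫⁻ Ψ, ∫⁻ g : Fin d → ℂ, ENNReal.ofReal (hxN (Ψ.1.mulVec g) ^ (2 * p)) ∂(Measure.pi fun _ => hxGam) ∂P := by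
          apply lintegral_lintegral_swap
          exact (hFc.comp ((hx_mulVec_cont d).comp continuous_swap)).measurable.aemeasurable
      _ = ∫⁻ g : Fin d → ℂ, ENNReal.ofReal (hxN g ^ (2 * p)) ∂(Measure.pi fun _ => hxGam) := by
          have := fun Ψ : Matrix.unitaryGroup (Fin d) ℂ => hx_gauss_inv Ψ _ hFc.measurable
          simp_rw [this]
          simp
      _ ≤ _ := hA d hd
  have hd' : (0:ℝ) < d := by exact_mod_cast hd
  have hB3 : B ≤ ENNReal.ofReal (C / (d:ℝ) ^ (3 * p)) := by
    have h1 : ENNReal.ofReal ((d:ℝ) ^ (4 * p)) ≠ 0 := (ENNReal.ofReal_pos.2 (by positivity)).ne'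
    refine (ENNReal.mul_le_mul_iff_right h1 ENNReal.ofReal_ne_top).1 (hB2.trans (le_of_eq ?_))
    rw [← ENNReal.ofReal_mul (by positivity)]
    congr 1
    field_simp
    ring
  rw [hgen v, ENNReal.ofReal_mul (by positivity)]
  gcongr

/-- sesquilinear pairing -/
noncomputable def hxP {d : ℕ} (a b : Fin d → ℂ) : ℂ := ∑ j, (starRingEnd ℂ) (a j) * b j

/-- the centered quartic form -/
noncomputable def hxT {d : ℕ} (a b c e : Fin d → ℂ) : ℂ :=
  (∑ j, (starRingEnd ℂ) (a j) * b j * (starRingEnd ℂ) (c j) * e j) -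
    (1 / (d : ℂ)) * (hxP a b * hxP c e + hxP a e * hxP c b)

lemma hxP_add_left {d : ℕ} (a a' b : Fin d → ℂ) : hxP (a + a') b = hxP a b + hxP a' b := by
  simp [hxP, add_mul, Finset.sum_add_distrib]

lemma hxP_add_right {d : ℕ} (a b b' : Fin d → ℂ) : hxP a (b + b') = hxP a b + hxP a b' := by
  simp [hxP, mul_add, Finset.sum_add_distrib]

lemma hxP_smul_left {d : ℕ} (t : ℂ) (a b : Fin d → ℂ) : hxP (t • a) b = (starRingEnd ℂ) t * hxP a b := by
  simp [hxP, Finset.mul_sum, mul_assoc]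

lemma hxP_smul_right {d : ℕ} (t : ℂ) (a b : Fin d → ℂ) : hxP a (t • b) = t * hxP a b := by
  simp only [hxP, Finset.mul_sum, Pi.smul_apply, smul_eq_mul]
  exact Finset.sum_congr rfl fun j _ => by ring

lemma hxT_sym13 {d : ℕ} (a b c e : Fin d → ℂ) : hxT c b a e = hxT a b c e := by
  simp only [hxT]
  congr 1
  · exact Finset.sum_congr rfl fun j _ => by ring
  · ring

lemma hxT_sym24 {d : ℕ} (a b c e : Fin d → ℂ) : hxT a e c b = hxT a b c e := by
  simp only [hxT]
  congr 1
  · exact Finset.sum_congr rfl fun j _ => by ring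
  · ring

lemma hxT_add1 {d : ℕ} (a a' b c e : Fin d → ℂ) : hxT (a + a') b c e = hxT a b c e + hxT a' b c e := by
  simp only [hxT, hxP_add_left, Pi.add_apply, map_add, add_mul, Finset.sum_add_distrib]
  ring

lemma hxT_add2 {d : ℕ} (a b b' c e : Fin d → ℂ) : hxT a (b + b') c e = hxT a b c e + hxT a b' c e := by
  simp only [hxT, hxP_add_right, Pi.add_apply, map_add, add_mul, mul_add, Finset.sum_add_distrib]
  ring

lemma hxT_smul1 {d : ℕ} (t : ℂ) (a b c e : Fin d → ℂ) : hxT (t • a) b c e = (starRingEnd ℂ) t * hxT a b c e := by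
  simp only [hxT, hxP_smul_left, Pi.smul_apply, smul_eq_mul, map_mul, mul_sub, Finset.mul_sum]
  congr 1
  · exact Finset.sum_congr rfl fun j _ => by ring
  · ring

lemma hxT_smul2 {d : ℕ} (t : ℂ) (a b c e : Fin d → ℂ) : hxT a (t • b) c e = t * hxT a b c e := by
  simp only [hxT, hxP_smul_right, Pi.smul_apply, smul_eq_mul, map_mul, mul_sub, Finset.mul_sum]
  congr 1
  · exact Finset.sum_congr rfl fun j _ => by ring
  · ring

lemma hxT_add3 {d : ℕ} (a b c c' e : Fin d → ℂ) : hxT a b (c + c') e = hxT a b c e + hxT a b c' e := by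
  rw [hxT_sym13, hxT_add1, hxT_sym13, hxT_sym13 c']

lemma hxT_add4 {d : ℕ} (a b c e e' : Fin d → ℂ) : hxT a b c (e + e') = hxT a b c e + hxT a b c e' := by
  rw [hxT_sym24, hxT_add2, hxT_sym24, hxT_sym24 a e']

lemma hxT_smul3 {d : ℕ} (t : ℂ) (a b c e : Fin d → ℂ) : hxT a b (t • c) e = (starRingEnd ℂ) t * hxT a b c e := by
  rw [hxT_sym13, hxT_smul1, hxT_sym13]

lemma hxT_smul4 {d : ℕ} (t : ℂ) (a b c e : Fin d → ℂ) : hxT a b c (t • e) = t * hxT a b c e := by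
  rw [hxT_sym24, hxT_smul2, hxT_sym24]

/-- the coefficients used in the polarization -/
noncomputable def hxZ : Fin 4 → ℂ := ![1, -1, Complex.I, -Complex.I]

noncomputable def hxS : Fin 6 → ℂ := ![1, 1, 1, 1, 1, 0]

noncomputable def hxR : Fin 6 → ℂ := ![1, -1, Complex.I, -Complex.I, 0, 1]

lemma hx_pol1 {d : ℕ} (a b c e : Fin d → ℂ) :
    4 * hxT a b c e = ∑ k, hxZ k * hxT (b + hxZ k • a) (b + hxZ k • a) c e := by
  simp only [Fin.sum_univ_four, hxT_add1, hxT_add2, hxT_smul1, hxT_smul2]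
  simp only [hxZ, Matrix.cons_val]
  simp only [map_one, map_neg, Complex.conj_I]
  ring_nf
  simp only [Complex.I_sq, show Complex.I ^ 3 = -Complex.I from by rw [pow_succ, Complex.I_sq]; ring]
  ring

lemma hx_pol2 {d : ℕ} (a b c e : Fin d → ℂ) :
    4 * hxT a b c e = ∑ k, hxZ k * hxT a b (e + hxZ k • c) (e + hxZ k • c) := by
  simp only [Fin.sum_univ_four, hxT_add3, hxT_add4, hxT_smul3, hxT_smul4]
  simp only [hxZ, Matrix.cons_val]
  simp only [map_one, map_neg, Complex.conj_I]
  ring_nf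
  simp only [Complex.I_sq, show Complex.I ^ 3 = -Complex.I from by rw [pow_succ, Complex.I_sq]; ring]
  ring

lemma hx_pol3 {d : ℕ} (v w : Fin d → ℂ) :
    16 * hxT v v w w = (∑ k, hxT (v + hxZ k • w) (v + hxZ k • w) (v + hxZ k • w) (v + hxZ k • w))
      - 4 * hxT v v v v - 4 * hxT w w w w := by
  simp only [Fin.sum_univ_four, hxT_add1, hxT_add2, hxT_smul1, hxT_smul2, hxT_add3, hxT_add4, hxT_smul3, hxT_smul4]
  simp only [hxZ, Matrix.cons_val]
  simp only [map_one, map_neg, Complex.conj_I]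
  have h1 : hxT v w w v = hxT v v w w := hxT_sym24 _ _ _ _
  have h2 : hxT w v v w = hxT v v w w := hxT_sym13 _ _ _ _
  have h3 : hxT w w v v = hxT v v w w := by rw [hxT_sym13, h1]
  rw [h1, h2, h3]
  ring_nf
  simp only [Complex.I_sq, show Complex.I ^ 3 = -Complex.I from by rw [pow_succ, Complex.I_sq]; ring,
    Complex.I_pow_four]
  ring

lemma hxZ_norm (k : Fin 4) : ‖hxZ k‖ = 1 := by
  fin_cases k <;> simp [hxZ]

lemma hxS_norm (k : Fin 6) : ‖hxS k‖ ≤ 1 := by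
  fin_cases k <;> simp [hxS]

lemma hxR_norm (k : Fin 6) : ‖hxR k‖ ≤ 1 := by
  fin_cases k <;> simp [hxR]

lemma hxT_diag {d : ℕ} (w : Fin d → ℂ) : hxT w w w w = (hxN w : ℂ) := by
  have h : ∀ j, (starRingEnd ℂ) (w j) * w j * (starRingEnd ℂ) (w j) * w j = ((‖w j‖ ^ 4 : ℝ) : ℂ) := by
    intro j
    rw [mul_assoc, Complex.conj_mul']; push_cast; ring
  have h2 : hxP w w = ((∑ j, ‖w j‖ ^ 2 : ℝ) : ℂ) := by
    simp [hxP, Complex.conj_mul']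
  simp only [hxT, h, h2, hxN]
  push_cast
  ring

lemma hx_bd1 {d : ℕ} (v w : Fin d → ℂ) : ‖hxT v v w w‖ ≤ ∑ t, |hxN (hxS t • v + hxR t • w)| := by
  have hq : ∀ w : Fin d → ℂ, |hxN w| = ‖hxT w w w w‖ := by
    intro w; rw [hxT_diag]; simp
  have h := congrArg norm (hx_pol3 v w)
  rw [norm_mul] at h
  simp only [Fin.sum_univ_six, hq]
  simp only [hxS, hxR, Matrix.cons_val, one_smul, zero_smul, add_zero, zero_add]
  simp only [Fin.sum_univ_four] at h
  simp only [hxZ, Matrix.cons_val, one_smul] at h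
  have e16 : ‖(16:ℂ)‖ = 16 := by simp
  have e4 : ‖(4:ℂ)‖ = 4 := by simp
  rw [e16] at h
  have h2 := norm_sub_le_of_le (norm_sub_le_of_le (norm_add_le_of_le (norm_add₃_le (a := hxT (v + w) (v + w) (v + w) (v + w))
    (b := hxT (v + (-1:ℂ) • w) (v + (-1:ℂ) • w) (v + (-1:ℂ) • w) (v + (-1:ℂ) • w))
    (c := hxT (v + Complex.I • w) (v + Complex.I • w) (v + Complex.I • w) (v + Complex.I • w)))
    (le_refl ‖hxT (v + (-Complex.I) • w) (v + (-Complex.I) • w) (v + (-Complex.I) • w) (v + (-Complex.I) • w)‖))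
    (le_refl ‖4 * hxT v v v v‖)) (le_refl ‖4 * hxT w w w w‖)
  rw [← h, norm_mul, norm_mul, e4] at h2
  have n1 := norm_nonneg (hxT (v + w) (v + w) (v + w) (v + w))
  have n2 := norm_nonneg (hxT (v + (-1:ℂ) • w) (v + (-1:ℂ) • w) (v + (-1:ℂ) • w) (v + (-1:ℂ) • w))
  have n3 := norm_nonneg (hxT (v + Complex.I • w) (v + Complex.I • w) (v + Complex.I • w) (v + Complex.I • w))
  have n4 := norm_nonneg (hxT (v + (-Complex.I) • w) (v + (-Complex.I) • w) (v + (-Complex.I) • w) (v + (-Complex.I) • w))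
  have n5 := norm_nonneg (hxT v v v v)
  have n6 := norm_nonneg (hxT w w w w)
  linarith

lemma hx_bd2 {d : ℕ} (a b c e : Fin d → ℂ) : ‖hxT a b c e‖ ≤ ∑ k, ∑ l,
    ‖hxT (b + hxZ k • a) (b + hxZ k • a) (e + hxZ l • c) (e + hxZ l • c)‖ := by
  have hone : ∀ x : ℂ, ‖x‖ ≤ ‖4 * x‖ := by
    intro x; rw [norm_mul]; simp; linarith [norm_nonneg x]
  refine (hone _).trans ?_
  rw [hx_pol1]
  refine (norm_sum_le _ _).trans (Finset.sum_le_sum fun k _ => ?_)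
  rw [norm_mul, hxZ_norm, one_mul]
  refine (hone _).trans ?_
  rw [hx_pol2]
  refine (norm_sum_le _ _).trans (Finset.sum_le_sum fun l _ => ?_)
  rw [norm_mul, hxZ_norm, one_mul]

/-- the test vectors -/
noncomputable def hxV {d : ℕ} (a b c e : Fin d → ℂ) (i : Fin 4 × Fin 4 × Fin 6) : Fin d → ℂ :=
  hxS i.2.2 • (b + hxZ i.1 • a) + hxR i.2.2 • (e + hxZ i.2.1 • c)

lemma hx_bd {d : ℕ} (a b c e : Fin d → ℂ) : ‖hxT a b c e‖ ≤ ∑ i, |hxN (hxV a b c e i)| := by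
  refine (hx_bd2 a b c e).trans ?_
  rw [Fintype.sum_prod_type]
  refine Finset.sum_le_sum fun k _ => ?_
  rw [Fintype.sum_prod_type]
  exact Finset.sum_le_sum fun l _ => hx_bd1 _ _

lemma hx_gam_eq {d : ℕ} (Ψ : Matrix.unitaryGroup (Fin d) ℂ) (k l m n : Fin d) :
    gam Ψ.1 k l m n = hxT (Ψ.1.mulVec (Pi.single k 1)) (Ψ.1.mulVec (Pi.single l 1))
      (Ψ.1.mulVec (Pi.single m 1)) (Ψ.1.mulVec (Pi.single n 1)) := by
  have hP : ∀ a b : Fin d, hxP (Ψ.1.mulVec (Pi.single a 1)) (Ψ.1.mulVec (Pi.single b 1))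
      = if a = b then 1 else 0 := by
    intro a b
    have h : Ψ.1.conjTranspose * Ψ.1 = 1 := (Matrix.mem_unitaryGroup_iff').1 Ψ.2
    have h2 := congrFun (congrFun h a) b
    rw [Matrix.mul_apply, Matrix.one_apply] at h2
    simpa [hxP] using h2
  simp only [gam, hxT, hP]
  simp only [Matrix.mulVec_single_one, Matrix.col_apply]
  rw [sub_sub, ← mul_add]
  congr 3 <;> · simp only [mul_ite, mul_one, mul_zero]; split_ifs <;> simp_all

lemma hx_V_mulVec {d : ℕ} (A : Matrix (Fin d) (Fin d) ℂ) (a b c e : Fin d → ℂ) (i : Fin 4 × Fin 4 × Fin 6) :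
    hxV (A.mulVec a) (A.mulVec b) (A.mulVec c) (A.mulVec e) i = A.mulVec (hxV a b c e i) := by
  simp only [hxV, Matrix.mulVec_add, Matrix.mulVec_smul]

lemma hx_sq_le {d : ℕ} (a b c e : Fin d → ℂ) (ha : ∑ j, ‖a j‖ ^ 2 = 1) (hb : ∑ j, ‖b j‖ ^ 2 = 1)
    (hc : ∑ j, ‖c j‖ ^ 2 = 1) (he : ∑ j, ‖e j‖ ^ 2 = 1) (i : Fin 4 × Fin 4 × Fin 6) :
    ∑ j, ‖hxV a b c e i j‖ ^ 2 ≤ 16 := by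
  have h : ∀ j, ‖hxV a b c e i j‖ ^ 2 ≤ 4 * (‖a j‖ ^ 2 + ‖b j‖ ^ 2 + ‖c j‖ ^ 2 + ‖e j‖ ^ 2) := by
    intro j
    have h1 : ‖hxV a b c e i j‖ ≤ ‖a j‖ + ‖b j‖ + ‖c j‖ + ‖e j‖ := by
      simp only [hxV, Pi.add_apply, Pi.smul_apply, smul_eq_mul]
      have q1 : ‖b j + hxZ i.1 * a j‖ ≤ ‖b j‖ + ‖a j‖ := by
        refine (norm_add_le _ _).trans ?_
        rw [norm_mul, hxZ_norm, one_mul]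
      have q2 : ‖e j + hxZ i.2.1 * c j‖ ≤ ‖e j‖ + ‖c j‖ := by
        refine (norm_add_le _ _).trans ?_
        rw [norm_mul, hxZ_norm, one_mul]
      refine (norm_add_le _ _).trans ?_
      rw [norm_mul, norm_mul]
      have q3 := mul_le_of_le_one_left (norm_nonneg (b j + hxZ i.1 * a j)) (hxS_norm i.2.2)
      have q4 := mul_le_of_le_one_left (norm_nonneg (e j + hxZ i.2.1 * c j)) (hxR_norm i.2.2)
      linarith
    have h2 := pow_le_pow_left₀ (norm_nonneg _) h1 2
    nlinarith [sq_nonneg (‖a j‖ - ‖b j‖), sq_nonneg (‖a j‖ - ‖c j‖), sq_nonneg (‖a j‖ - ‖e j‖),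
      sq_nonneg (‖b j‖ - ‖c j‖), sq_nonneg (‖b j‖ - ‖e j‖), sq_nonneg (‖c j‖ - ‖e j‖)]
  refine (Finset.sum_le_sum fun j _ => h j).trans (le_of_eq ?_)
  rw [← Finset.mul_sum]
  simp only [Finset.sum_add_distrib, ha, hb, hc, he]
  norm_num

/-- Uniform moment bound: `E|γ(k,ℓ,m,n)|^{2p} ≤ C_p d^{-3p}` for all indices. -/
theorem stmt12 (p : ℕ) (hp : 1 ≤ p) :
    ∃ C > (0 : ℝ), ∀ d : ℕ, 1 ≤ d →
      ∀ [MeasurableSpace (Matrix.unitaryGroup (Fin d) ℂ)]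
        [BorelSpace (Matrix.unitaryGroup (Fin d) ℂ)]
        (P : Measure (Matrix.unitaryGroup (Fin d) ℂ)) [IsProbabilityMeasure P],
        (∀ g : Matrix.unitaryGroup (Fin d) ℂ, P.map (fun x => g * x) = P) →
        ∀ k l m n : Fin d,
          (∫ Ψ, ‖gam Ψ.1 k l m n‖ ^ (2 * p) ∂P) ≤ C / (d : ℝ) ^ (3 * p) := by
  obtain ⟨C, hC, hH⟩ := hx_haar p hp
  refine ⟨96 ^ (2 * p - 1) * (96 * (16 ^ (4 * p) * C)) + 1, by positivity, fun d hd _ _ P _ hP k l m n => ?_⟩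
  have hd' : (0:ℝ) < d := by exact_mod_cast hd
  have hs : ∀ i : Fin d, ∑ j, ‖(Pi.single i 1 : Fin d → ℂ) j‖ ^ 2 = 1 := by
    intro i
    rw [Finset.sum_eq_single i]
    · simp
    · intro j _ hj; simp [hj]
    · simp
  set x : Fin 4 × Fin 4 × Fin 6 → Fin d → ℂ :=
    hxV (Pi.single k 1) (Pi.single l 1) (Pi.single m 1) (Pi.single n 1) with hx
  have hpt : ∀ Ψ : Matrix.unitaryGroup (Fin d) ℂ, ‖gam Ψ.1 k l m n‖ ^ (2 * p) ≤
      96 ^ (2 * p - 1) * ∑ i, hxN (Ψ.1.mulVec (x i)) ^ (2 * p) := by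
    intro Ψ
    have h1 : ‖gam Ψ.1 k l m n‖ ≤ ∑ i, |hxN (Ψ.1.mulVec (x i))| := by
      rw [hx_gam_eq]
      refine (hx_bd _ _ _ _).trans (le_of_eq ?_)
      simp only [hx_V_mulVec, hx]
    have h2 := pow_sum_div_card_le_sum_pow (s := (Finset.univ : Finset (Fin 4 × Fin 4 × Fin 6)))
      (f := fun i => |hxN (Ψ.1.mulVec (x i))|) (n := 2 * p - 1) (fun i _ => abs_nonneg _)
    rw [show 2 * p - 1 + 1 = 2 * p by omega, div_le_iff₀' (by simp)] at h2
    simp only [(even_two_mul p).pow_abs] at h2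
    refine (pow_le_pow_left₀ (norm_nonneg _) h1 _).trans (h2.trans (le_of_eq ?_))
    simp
  have hmv : ∀ w : Fin d → ℂ, Continuous fun Ψ : Matrix.unitaryGroup (Fin d) ℂ => Ψ.1.mulVec w :=
    fun w => (hx_mulVec_cont d).comp (by fun_prop : Continuous fun Ψ => (Ψ, w))
  have hg : Continuous fun Ψ : Matrix.unitaryGroup (Fin d) ℂ => ‖gam Ψ.1 k l m n‖ ^ (2 * p) := by
    have he : ∀ j i, Continuous fun Ψ : Matrix.unitaryGroup (Fin d) ℂ => Ψ.1 j i := fun j i =>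
      (continuous_apply_apply j i).comp continuous_subtype_val
    have hc : ∀ j i, Continuous fun Ψ : Matrix.unitaryGroup (Fin d) ℂ => (starRingEnd ℂ) (Ψ.1 j i) :=
      fun j i => Complex.continuous_conj.comp (he j i)
    unfold gam
    refine Continuous.pow (Continuous.norm ?_) _
    refine ((continuous_finsetSum _ fun j _ => ?_).sub continuous_const).sub continuous_const
    exact (((hc j k).mul (he j l)).mul (hc j m)).mul (he j n)
  rw [integral_eq_lintegral_of_nonneg_ae (Filter.Eventually.of_forall fun _ => by positivity)
    hg.measurable.aestronglyMeasurable]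
  refine ENNReal.toReal_le_of_le_ofReal (by positivity) ?_
  calc ∫⁻ Ψ, ENNReal.ofReal (‖gam Ψ.1 k l m n‖ ^ (2 * p)) ∂P
      ≤ ∫⁻ Ψ, ENNReal.ofReal (96 ^ (2 * p - 1)) * ∑ i, ENNReal.ofReal (hxN (Ψ.1.mulVec (x i)) ^ (2 * p)) ∂P := by
        refine lintegral_mono fun Ψ => ?_
        dsimp only
        rw [← ENNReal.ofReal_sum_of_nonneg fun i _ => (even_two_mul p).pow_nonneg _,
          ← ENNReal.ofReal_mul (by positivity)]
        exact ENNReal.ofReal_le_ofReal (hpt Ψ)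
    _ = ENNReal.ofReal (96 ^ (2 * p - 1)) * ∑ i, ∫⁻ Ψ, ENNReal.ofReal (hxN (Ψ.1.mulVec (x i)) ^ (2 * p)) ∂P := by
        have hm : ∀ i, Measurable fun Ψ : Matrix.unitaryGroup (Fin d) ℂ =>
            ENNReal.ofReal (hxN (Ψ.1.mulVec (x i)) ^ (2 * p)) := fun i =>
          (ENNReal.continuous_ofReal.comp ((hxN_cont.comp (hmv (x i))).pow _)).measurable
        rw [lintegral_const_mul _ (Finset.measurable_fun_sum _ fun i _ => hm i),
          lintegral_finsetSum _ fun i _ => hm i]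
    _ ≤ ENNReal.ofReal (96 ^ (2 * p - 1)) * ∑ i : Fin 4 × Fin 4 × Fin 6, ENNReal.ofReal (16 ^ (4 * p) * (C / (d:ℝ) ^ (3 * p))) := by
        gcongr with i
        refine (hH d hd P hP (x i)).trans (ENNReal.ofReal_le_ofReal ?_)
        have := hx_sq_le _ _ _ _ (hs k) (hs l) (hs m) (hs n) i
        gcongr
    _ ≤ _ := by
        rw [← ENNReal.ofReal_sum_of_nonneg fun i _ => by positivity,
          ← ENNReal.ofReal_mul (by positivity)]
        apply ENNReal.ofReal_le_ofReal
        rw [Finset.sum_const, Finset.card_univ]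
        simp only [Fintype.card_prod, Fintype.card_fin, nsmul_eq_mul]
        rw [le_div_iff₀ (by positivity)]
        norm_num
        field_simp
        linarith
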